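/- Let $W:[0,\infty)\to$ ($n\times n$ complex matrices) be continuous, let $\gamma\in\mathbb{C}$, let $i\ge 0$, and let $F$ be a function from an open neighborhood of $\gamma$ in $\mathbb{C}$ to $n\times n$ complex matrices that is $i$ times differentiable at $\gamma$ (in the complex sense). Define $Z(\theta,x)=e^{\theta x}\big(I-\big(\int_0^x e^{-\theta y}W(y)\,dy\big)F(\theta)\big)$. Then for every $x\ge 0$ the $i$-th partial derivative of $Z$ in $\theta$ at $(\gamma,x)$ equals $x^i e^{\gamma x} I - \sum_{k=0}^{i}\binom{i}{k}\big(\int_0^x (x-y)^k e^{\gamma(x-y)}W(y)\,dy\big)F^{(i-k)}(\gamma)$. -/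

import Mathlib

open MeasureTheory Filter Matrix intervalIntegral

attribute [local instance] Matrix.normedAddCommGroup Matrix.normedSpace

theorem leibniz_aux {E : Type*} [NormedAddCommGroup E] [NormedSpace ℂ E] [CompleteSpace E]
    (B : E →L[ℂ] E →L[ℂ] E) (G : ℕ → ℂ → E)
    (hG : ∀ k θ, HasDerivAt (G k) (G (k + 1) θ) θ) (γ : ℂ) (i : ℕ) :
    ∀ (m : ℕ) (F : ℂ → E), ContDiffAt ℂ i F γ →
      iteratedDeriv i (fun θ => B (G m θ) (F θ)) γ =
        ∑ p ∈ Finset.HasAntidiagonal.antidiagonal i, (i.choose p.1) •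
          B (G (m + p.1) γ) (iteratedDeriv p.2 F γ) := by
  have hGc : ∀ k (N : ℕ), ContDiff ℂ N (G k) := fun k N =>
    Differentiable.contDiff (fun θ => (hG k θ).differentiableAt)
  have hBc : ∀ (N : ℕ) (k : ℕ) (F : ℂ → E), ContDiffAt ℂ N F γ →
      ContDiffAt ℂ N (fun θ => B (G k θ) (F θ)) γ := fun N k F hF =>
    (B.contDiff.contDiffAt.comp γ (hGc k N).contDiffAt).clm_apply hF
  induction i with
  | zero => intro m F _; simp
  | succ i ih =>
    intro m F hF
    have hF' : ContDiffAt ℂ i (deriv F) γ := by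
      have h2 : ContDiffAt ℂ i (fderiv ℂ F) γ := hF.fderiv_right (by norm_cast)
      exact h2.clm_apply contDiffAt_const
    have hF0 : ContDiffAt ℂ i F γ := hF.of_le (by exact_mod_cast Nat.le_succ i)
    have hev : ∀ᶠ θ in nhds γ, DifferentiableAt ℂ F θ := by
      have h1 : ContDiffAt ℂ 1 F γ := hF.of_le (by exact_mod_cast Nat.succ_le_succ (Nat.zero_le i))
      filter_upwards [h1.eventually (by simp)] with θ h
      exact h.differentiableAt (by simp)
    have key : deriv (fun θ => B (G m θ) (F θ)) =ᶠ[nhds γ]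
        ((fun θ => B (G (m + 1) θ) (F θ)) + (fun θ => B (G m θ) (deriv F θ))) := by
      filter_upwards [hev] with θ h
      have h1 : HasDerivAt (fun θ => B (G m θ)) (B (G (m + 1) θ)) θ :=
        B.hasFDerivAt.comp_hasDerivAt θ (hG m θ)
      exact (h1.clm_apply h.hasDerivAt).deriv
    rw [iteratedDeriv_succ', key.iteratedDeriv_eq, iteratedDeriv_add (hBc _ _ _ hF0) (hBc _ _ _ hF'),
      ih _ _ hF0, ih _ _ hF',
      Finset.sum_antidiagonal_choose_succ_nsmul
        (fun a b => B (G (m + a) γ) (iteratedDeriv b F γ)) i, add_comm]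
    congr 1
    · refine Finset.sum_congr rfl fun p _ => ?_
      rw [iteratedDeriv_succ']
    · refine Finset.sum_congr rfl fun p hp => ?_
      rw [← Nat.choose_symm_of_eq_add (Finset.HasAntidiagonal.mem_antidiagonal.1 hp).symm, Nat.add_assoc,
        Nat.add_comm 1]

theorem integral_aux {E : Type*} [NormedAddCommGroup E] [NormedSpace ℂ E] [CompleteSpace E]
    (W : ℝ → E) (hW : ContinuousOn W (Set.Ici 0)) (x : ℝ) (hx : 0 ≤ x) (k : ℕ) (θ : ℂ) :
    HasDerivAt (fun θ : ℂ => ∫ y in (0 : ℝ)..x,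
        (((x : ℂ) - (y : ℂ)) ^ k * Complex.exp (θ * ((x : ℂ) - (y : ℂ)))) • W y)
      (∫ y in (0 : ℝ)..x,
        (((x : ℂ) - (y : ℂ)) ^ (k + 1) * Complex.exp (θ * ((x : ℂ) - (y : ℂ)))) • W y) θ := by
  have hW' : ContinuousOn W (Set.uIcc 0 x) := hW.mono (by
    rw [Set.uIcc_of_le hx]; exact Set.Icc_subset_Ici_self)
  have hc : ∀ (k : ℕ) (θ : ℂ), IntervalIntegrable (fun y : ℝ =>
      (((x : ℂ) - (y : ℂ)) ^ k * Complex.exp (θ * ((x : ℂ) - (y : ℂ)))) • W y) volume 0 x := by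
    intro k θ
    apply ContinuousOn.intervalIntegrable
    exact ContinuousOn.smul (by fun_prop) hW'
  refine (intervalIntegral.hasDerivAt_integral_of_dominated_loc_of_deriv_le
    (F := fun (θ : ℂ) (y : ℝ) =>
      (((x : ℂ) - (y : ℂ)) ^ k * Complex.exp (θ * ((x : ℂ) - (y : ℂ)))) • W y)
    (F' := fun (θ : ℂ) (y : ℝ) =>
      (((x : ℂ) - (y : ℂ)) ^ (k + 1) * Complex.exp (θ * ((x : ℂ) - (y : ℂ)))) • W y)
    (bound := fun y : ℝ => (‖(x : ℂ) - (y : ℂ)‖ ^ (k + 1) *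
      Real.exp ((‖θ‖ + 1) * ‖(x : ℂ) - (y : ℂ)‖)) * ‖W y‖)
    (Metric.ball_mem_nhds θ one_pos) ?_ (hc k θ) ?_ ?_ ?_ ?_).2
  · exact Filter.Eventually.of_forall fun θ => (intervalIntegrable_iff.1 (hc k θ)).1
  · exact (intervalIntegrable_iff.1 (hc (k + 1) θ)).1
  · refine Filter.Eventually.of_forall fun y _ z hz => ?_
    rw [norm_smul, norm_mul, norm_pow]
    have h1 : ‖z‖ ≤ ‖θ‖ + 1 := by
      have h2 := norm_sub_norm_le z θ
      have h3 : ‖z - θ‖ < 1 := by simpa [dist_eq_norm] using hz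
      linarith
    have h2 : ‖Complex.exp (z * ((x : ℂ) - (y : ℂ)))‖ ≤
        Real.exp ((‖θ‖ + 1) * ‖(x : ℂ) - (y : ℂ)‖) := by
      refine (Complex.norm_exp_le_exp_norm _).trans ?_
      rw [norm_mul]
      gcongr
    gcongr
  · apply ContinuousOn.intervalIntegrable
    exact ContinuousOn.mul (by fun_prop) hW'.norm
  · refine Filter.Eventually.of_forall fun y _ z _ => ?_
    have h1 : HasDerivAt (fun z : ℂ => z * ((x : ℂ) - (y : ℂ))) ((x : ℂ) - (y : ℂ)) z := by
      simpa using (hasDerivAt_id z).mul_const ((x : ℂ) - (y : ℂ))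
    have h2 := ((h1.cexp.const_mul (((x : ℂ) - (y : ℂ)) ^ k))).smul_const (W y)
    convert h2 using 2
    ring

/-- Let `W : [0,∞) →` (complex `n × n` matrices) be continuous, let `F` be `i`
times complex differentiable at `γ`, and set
`Z θ x = e^{θ x} (I - (∫_0^x e^{-θ y} W(y) dy) F(θ))`. Then for every `x ≥ 0` the `i`-th partial
derivative of `Z` in `θ` at `(γ, x)` equals
`x^i e^{γ x} I - ∑_{k=0}^{i} (i choose k) (∫_0^x (x-y)^k e^{γ (x-y)} W(y) dy) F^{(i-k)}(γ)`. -/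
theorem Z_theta_derivative_formula
    (n : ℕ) (W : ℝ → Matrix (Fin n) (Fin n) ℂ) (hW : ContinuousOn W (Set.Ici 0))
    (γ : ℂ) (i : ℕ) (F : ℂ → Matrix (Fin n) (Fin n) ℂ) (hF : ContDiffAt ℂ i F γ)
    (Z : ℂ → ℝ → Matrix (Fin n) (Fin n) ℂ)
    (hZ : ∀ θ : ℂ, ∀ x : ℝ, Z θ x =
      Complex.exp (θ * x) •
        ((1 : Matrix (Fin n) (Fin n) ℂ) -
          (∫ y in (0 : ℝ)..x, Complex.exp (-θ * y) • W y) * F θ)) :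
    ∀ x : ℝ, 0 ≤ x →
      iteratedDeriv i (fun θ => Z θ x) γ =
        ((x : ℂ) ^ i * Complex.exp (γ * x)) • (1 : Matrix (Fin n) (Fin n) ℂ) -
          ∑ k ∈ Finset.range (i + 1), (i.choose k : ℂ) •
            ((∫ y in (0 : ℝ)..x,
                (((x : ℂ) - (y : ℂ)) ^ k * Complex.exp (γ * ((x : ℂ) - (y : ℂ)))) • W y) *
              iteratedDeriv (i - k) F γ) := by
  intro x hx
  let B0 : Matrix (Fin n) (Fin n) ℂ →ₗ[ℂ] Matrix (Fin n) (Fin n) ℂ →ₗ[ℂ] Matrix (Fin n) (Fin n) ℂ :=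
    LinearMap.mul ℂ (Matrix (Fin n) (Fin n) ℂ)
  let B : Matrix (Fin n) (Fin n) ℂ →L[ℂ] Matrix (Fin n) (Fin n) ℂ →L[ℂ] Matrix (Fin n) (Fin n) ℂ :=
    LinearMap.toContinuousLinearMap (LinearMap.toContinuousLinearMap.toLinearMap ∘ₗ B0)
  have hB : ∀ a b, B a b = a * b := fun a b => rfl
  let G : ℕ → ℂ → Matrix (Fin n) (Fin n) ℂ := fun k θ => ∫ y in (0 : ℝ)..x,
        (((x : ℂ) - (y : ℂ)) ^ k * Complex.exp (θ * ((x : ℂ) - (y : ℂ)))) • W y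
  have hG : ∀ k θ, HasDerivAt (G k) (G (k + 1) θ) θ := fun k θ => integral_aux W hW x hx k θ
  have hL := leibniz_aux B G hG γ i 0 F hF
  have hZ' : (fun θ => Z θ x) =
      (fun θ : ℂ => Complex.exp (x * θ) • (1 : Matrix (Fin n) (Fin n) ℂ)) -
        (fun θ => B (G 0 θ) (F θ)) := by
    funext θ
    have h0 : Complex.exp (θ * x) • (∫ y in (0 : ℝ)..x, Complex.exp (-θ * y) • W y) = G 0 θ := by
      rw [← intervalIntegral.integral_smul]
      refine intervalIntegral.integral_congr fun y _ => ?_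
      simp only [smul_smul, ← Complex.exp_add, pow_zero, one_mul]
      congr 2
      ring
    rw [hZ, Pi.sub_apply, smul_sub, hB, ← Matrix.smul_mul, h0, mul_comm θ]
  have hE : ContDiff ℂ i (fun θ : ℂ => Complex.exp (x * θ)) := by fun_prop
  have hGB : ContDiffAt ℂ i (fun θ => B (G 0 θ) (F θ)) γ := by
    have h0 : ContDiff ℂ i (G 0) :=
      Differentiable.contDiff (fun θ => (hG 0 θ).differentiableAt)
    exact (B.contDiff.contDiffAt.comp γ h0.contDiffAt).clm_apply hF
  have hE1 : ContDiffAt ℂ i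
      (fun θ : ℂ => Complex.exp (x * θ) • (1 : Matrix (Fin n) (Fin n) ℂ)) γ :=
    (hE.smul contDiff_const).contDiffAt
  have hE2 : iteratedDeriv i (fun θ : ℂ => Complex.exp (x * θ) • (1 : Matrix (Fin n) (Fin n) ℂ)) γ =
      ((x : ℂ) ^ i * Complex.exp (γ * x)) • (1 : Matrix (Fin n) (Fin n) ℂ) := by
    refine (iteratedDeriv_smul_const hE.contDiffAt _).trans ?_
    rw [iteratedDeriv_cexp_const_mul, mul_comm γ]
  rw [hZ']
  refine (iteratedDeriv_sub hE1 hGB).trans ?_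
  refine congrArg₂ (· - ·) hE2 (hL.trans ?_)
  rw [Finset.Nat.sum_antidiagonal_eq_sum_range_succ_mk]
  refine Finset.sum_congr rfl fun k _ => ?_
  simp only [hB, zero_add, Nat.cast_smul_eq_nsmul]
  rfl
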